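/- arXiv:math/0311143 — 4 statements merged into one kernel-verified Lean document; each statement's English description precedes it below -/
import Mathlib

section
/- Let G be a finite abelian group, g, g' ∈ G, and χ, χ' : G → ℂˣ group homomorphisms. Then the matrix of Lusztig pairings squares to the identity: ∑_{z ∈ G} ∑_{η : G →* ℂˣ} {(g,χ),(z,η)} · {(z,η),(g',χ')} equals 1 if g = g' and χ = χ', and equals 0 otherwise. (The inner sum runs over all group homomorphisms η : G → ℂˣ.) -/
/-- The Lusztig pairing for a finite abelian group `G` (all centralizers equal `G`
and irreducible characters are the homomorphisms `G →* ℂˣ`):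
`{(g,χ),(g',χ')} = |G|⁻¹ · χ(g') · χ'(g)⁻¹`. -/
noncomputable def pairAb {G : Type*} [CommGroup G] [Fintype G]
    (g : G) (χ : G →* ℂˣ) (g' : G) (χ' : G →* ℂˣ) : ℂ :=
  (Fintype.card G : ℂ)⁻¹ * (χ g' : ℂ) * (((χ' g)⁻¹ : ℂˣ) : ℂ)

/-- Orthogonality: sum of a homomorphism into the units of `ℂ`. -/
theorem sum_unitsHom {H : Type*} [Group H] [Fintype H] (f : H →* ℂˣ) [Decidable (f = 1)] :
    ∑ x : H, (f x : ℂ) = if f = 1 then (Fintype.card H : ℂ) else 0 := by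
  split_ifs with h
  · subst h; simp
  · refine sum_hom_units_eq_zero ((Units.coeHom ℂ).comp f) fun h' => h ?_
    ext x
    simpa using DFunLike.congr_fun h' x

open Classical in
/-- For a finite abelian group G, the matrix of Lusztig pairings,
indexed by M(G) = {(z,η) : z ∈ G, η : G →* ℂˣ}, squares to the identity:
∑_{z,η} {(g,χ),(z,η)}·{(z,η),(g',χ')} = 1 if (g,χ) = (g',χ') and 0 otherwise. -/
theorem pairAb_matrix_square_eq_one
    {G : Type*} [CommGroup G] [Fintype G] [Fintype (G →* ℂˣ)]
    (g g' : G) (χ χ' : G →* ℂˣ) :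
    ∑ z : G, ∑ η : G →* ℂˣ, pairAb g χ z η * pairAb z η g' χ' =
      if g = g' ∧ χ = χ' then 1 else 0 := by
  have hcard : (Fintype.card (G →* ℂˣ) : ℂ) = Fintype.card G := by
    rw [← Nat.card_eq_fintype_card, ← Nat.card_eq_fintype_card,
      CommGroup.card_monoidHom_of_hasEnoughRootsOfUnity]
  have hG : (Fintype.card G : ℂ) ≠ 0 := Nat.cast_ne_zero.2 Fintype.card_ne_zero
  have h1 := sum_unitsHom (χ * χ'⁻¹)
  have h2 := sum_unitsHom (MonoidHom.eval (M := G) (N := ℂˣ) (g' * g⁻¹))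
  have e1 : χ * χ'⁻¹ = 1 ↔ χ = χ' := by
    simp [DFunLike.ext_iff, mul_inv_eq_one]
  have e2 : MonoidHom.eval (M := G) (N := ℂˣ) (g' * g⁻¹) = 1 ↔ g = g' := by
    rw [eq_comm (a := g), ← CommGroup.forall_apply_eq_apply_iff G (M := ℂ), DFunLike.ext_iff]
    simp [mul_inv_eq_one]
  simp only [e1] at h1
  simp only [e2, hcard] at h2
  have key : ∑ z : G, ∑ η : G →* ℂˣ, pairAb g χ z η * pairAb z η g' χ' =
      (Fintype.card G : ℂ)⁻¹ ^ 2 * ((∑ z : G, (((χ * χ'⁻¹) z : ℂˣ) : ℂ)) *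
        ∑ η : G →* ℂˣ, ((MonoidHom.eval (M := G) (N := ℂˣ) (g' * g⁻¹) η : ℂˣ) : ℂ)) := by
    rw [Finset.sum_mul_sum, Finset.mul_sum]
    refine Finset.sum_congr rfl fun z _ => ?_
    rw [Finset.mul_sum]
    refine Finset.sum_congr rfl fun η _ => ?_
    simp only [pairAb, MonoidHom.mul_apply, MonoidHom.inv_apply, MonoidHom.eval_apply_apply,
      map_mul, map_inv, Units.val_mul]
    ring
  rw [key, h1, h2]
  by_cases a : g = g' <;> by_cases b : χ = χ' <;> simp [a, b]
  field_simp
end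

section
/- Let G be a finite abelian group. For pairs m = (g,χ), m' = (g',χ'), m'' = (g'',χ'') with g, g', g'' ∈ G and χ, χ', χ'' : G → ℂˣ group homomorphisms, define the structure constant p_{m,m',m''} = ∑_{z ∈ G} ∑_{η : G →* ℂˣ} |G| · {(g,χ),(z,η)} · {(g',χ'),(z,η)} · {(z,η),(g'',χ'')}. Then p_{m,m',m''} = 1 if g'' = gg' and χ'' = χχ', and p_{m,m',m''} = 0 otherwise. In particular, when every element of G satisfies g² = 1 (so M(G) = G × Hom(G,ℂˣ) is an 𝔽₂-vector space), p_{m,m',m''} = 1 if m + m' + m'' = 0 and p_{m,m',m''} = 0 if m + m' + m'' ≠ 0. -/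
/-- Orthogonality over the group. -/
theorem pairAb_sum_group {G : Type*} [CommGroup G] [Fintype G] (ψ : G →* ℂˣ)
    [Decidable (ψ = 1)] :
    (∑ z : G, (ψ z : ℂ)) = if ψ = 1 then (Fintype.card G : ℂ) else 0 := by
  classical
  have h := sum_hom_units ((Units.coeHom ℂ).comp ψ)
  have e : (Units.coeHom ℂ).comp ψ = 1 ↔ ψ = 1 := by
    simp [MonoidHom.ext_iff]
  simp only [e] at h
  simpa using h

/-- Orthogonality over the dual group. -/
theorem pairAb_sum_dual {G : Type*} [CommGroup G] [Fintype G] [Fintype (G →* ℂˣ)] (a : G)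
    [Decidable (a = 1)] :
    (∑ η : G →* ℂˣ, (η a : ℂ)) = if a = 1 then (Fintype.card G : ℂ) else 0 := by
  classical
  have hc : Fintype.card (G →* ℂˣ) = Fintype.card G := by
    have := CommGroup.card_monoidHom_of_hasEnoughRootsOfUnity G ℂ
    simpa [Nat.card_eq_fintype_card] using this
  have h := pairAb_sum_group (MonoidHom.eval a : (G →* ℂˣ) →* ℂˣ)
  have e : (MonoidHom.eval a : (G →* ℂˣ) →* ℂˣ) = 1 ↔ a = 1 := by
    constructor
    · intro h1
      by_contra ha
      obtain ⟨φ, hφ⟩ := CommGroup.exists_apply_ne_one_of_hasEnoughRootsOfUnity G ℂ ha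
      exact hφ (by simpa using DFunLike.congr_fun h1 φ)
    · rintro rfl
      ext φ
      simp
  simp only [e, hc] at h
  simpa using h

open Classical in
/-- For a finite abelian group G and m = (g,χ), m' = (g',χ'),
m'' = (g'',χ'') in M(G) = G × Hom(G,ℂˣ), the structure constant
p_{m,m',m''} = ∑_{z,η} |G| · {m,(z,η)}·{m',(z,η)}·{(z,η),m''} equals 1 if
g'' = gg' and χ'' = χχ', and 0 otherwise. In particular, when every element of G
satisfies g² = 1 (so M(G) is an 𝔽₂-vector space), p_{m,m',m''} = 1 if
m + m' + m'' = 0 and p_{m,m',m''} = 0 otherwise. -/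
theorem pairAb_structure_constants
    {G : Type*} [CommGroup G] [Fintype G] [Fintype (G →* ℂˣ)]
    (g g' g'' : G) (χ χ' χ'' : G →* ℂˣ) :
    (∑ z : G, ∑ η : G →* ℂˣ,
        (Fintype.card G : ℂ) * pairAb g χ z η * pairAb g' χ' z η * pairAb z η g'' χ'') =
      (if g'' = g * g' ∧ χ'' = χ * χ' then 1 else 0) ∧
    ((∀ x : G, x * x = 1) →
      (∑ z : G, ∑ η : G →* ℂˣ,
          (Fintype.card G : ℂ) * pairAb g χ z η * pairAb g' χ' z η * pairAb z η g'' χ'') =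
        if g * g' * g'' = 1 ∧ χ * χ' * χ'' = 1 then 1 else 0) := by
  have main : (∑ z : G, ∑ η : G →* ℂˣ,
        (Fintype.card G : ℂ) * pairAb g χ z η * pairAb g' χ' z η * pairAb z η g'' χ'') =
      (if g'' = g * g' ∧ χ'' = χ * χ' then 1 else 0) := by
    have hG : (Fintype.card G : ℂ) ≠ 0 := Nat.cast_ne_zero.2 Fintype.card_ne_zero
    have h1 : (∑ z : G, ∑ η : G →* ℂˣ,
        (Fintype.card G : ℂ) * pairAb g χ z η * pairAb g' χ' z η * pairAb z η g'' χ'') =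
        ((Fintype.card G : ℂ)⁻¹ * (∑ z : G, ((χ * χ' * χ''⁻¹) z : ℂ))) *
        ((Fintype.card G : ℂ)⁻¹ * (∑ η : G →* ℂˣ, (η (g'' * (g * g')⁻¹) : ℂ))) := by
      rw [Finset.mul_sum, Finset.mul_sum, Finset.sum_mul_sum]
      refine Finset.sum_congr rfl fun z _ => Finset.sum_congr rfl fun η _ => ?_
      simp only [pairAb, MonoidHom.mul_apply, MonoidHom.inv_apply, map_mul, map_inv, mul_inv,
        Units.val_mul]
      field_simp
    have e1 : χ * χ' * χ''⁻¹ = 1 ↔ χ'' = χ * χ' := by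
      rw [MonoidHom.ext_iff, MonoidHom.ext_iff]
      refine forall_congr' fun z => ?_
      rw [MonoidHom.mul_apply, MonoidHom.inv_apply, MonoidHom.one_apply, mul_inv_eq_one, eq_comm]
    have e2 : g'' * (g * g')⁻¹ = 1 ↔ g'' = g * g' := mul_inv_eq_one
    rw [h1, pairAb_sum_group, pairAb_sum_dual]
    simp only [e1, e2]
    by_cases ha : g'' = g * g' <;> by_cases hb : χ'' = χ * χ' <;> simp [ha, hb, hG]
  refine ⟨main, fun hx => ?_⟩
  rw [main]
  have hi : g''⁻¹ = g'' := inv_eq_of_mul_eq_one_left (hx g'')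
  have hj : ∀ z, (χ'' z)⁻¹ = χ'' z := fun z => by
    refine inv_eq_of_mul_eq_one_left ?_
    rw [← map_mul, hx, map_one]
  have e1 : g * g' * g'' = 1 ↔ g'' = g * g' := by
    rw [mul_eq_one_iff_eq_inv, hi, eq_comm]
  have e2 : χ * χ' * χ'' = 1 ↔ χ'' = χ * χ' := by
    rw [MonoidHom.ext_iff, MonoidHom.ext_iff]
    refine forall_congr' fun z => ?_
    rw [MonoidHom.mul_apply, MonoidHom.one_apply, mul_eq_one_iff_eq_inv, hj, eq_comm]
  simp only [e1, e2]
end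

section
/- Let G be a finite group. Let R ⊆ G be a set of representatives for the conjugacy classes of G, and for each r ∈ R let Irr(r) be a finite family of characters of pairwise non-isomorphic irreducible finite-dimensional complex representations of Z_G(r) such that every irreducible finite-dimensional complex representation of Z_G(r) is isomorphic to one of them. Then for g, g' ∈ R, χ ∈ Irr(g), χ' ∈ Irr(g'), one has ∑_{z ∈ R} ∑_{η ∈ Irr(z)} {(g,χ),(z,η)} · {(z,η),(g',χ')} = 1 if g = g' and χ = χ', and = 0 otherwise; that is, the matrix ({m,m'})_{m,m' ∈ M(G)} indexed by M(G) = {(r,χ) : r ∈ R, χ ∈ Irr(r)} has square equal to the identity matrix. -/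
/-- If h⁻¹gh centralizes g', then hg'h⁻¹ centralizes g. -/
theorem mem_centralizer_conj {G : Type*} [Group G] {g g' h : G}
    (hh : h⁻¹ * g * h ∈ Subgroup.centralizer ({g'} : Set G)) :
    h * g' * h⁻¹ ∈ Subgroup.centralizer ({g} : Set G) := by
  rw [Subgroup.mem_centralizer_singleton_iff] at hh ⊢
  calc (h * g' * h⁻¹) * g = h * (g' * (h⁻¹ * g * h)) * h⁻¹ := by group
    _ = h * ((h⁻¹ * g * h) * g') * h⁻¹ := by rw [← hh]
    _ = g * (h * g' * h⁻¹) := by group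

/-- If h⁻¹gh centralizes g', then so does h⁻¹g⁻¹h. -/
theorem mem_centralizer_conj_inv {G : Type*} [Group G] {g g' h : G}
    (hh : h⁻¹ * g * h ∈ Subgroup.centralizer ({g'} : Set G)) :
    h⁻¹ * g⁻¹ * h ∈ Subgroup.centralizer ({g'} : Set G) := by
  have : h⁻¹ * g⁻¹ * h = (h⁻¹ * g * h)⁻¹ := by group
  rw [this]
  exact inv_mem hh

/-- Lusztig's pairing {(g,χ),(g',χ')} for a finite group `G`,
where `χ` is a (class) function on the centralizer of `g` and `χ'` one
on the centralizer of `g'`: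
`{(g,χ),(g',χ')} = |Z_G(g)|⁻¹ |Z_G(g')|⁻¹ ∑_{h : h⁻¹gh ∈ Z_G(g')} χ(hg'h⁻¹) χ'(h⁻¹g⁻¹h)`. -/
noncomputable def lusztigPair {G : Type*} [Group G] [Fintype G]
    (g g' : G) (χ : Subgroup.centralizer ({g} : Set G) → ℂ)
    (χ' : Subgroup.centralizer ({g'} : Set G) → ℂ) : ℂ :=
  letI : DecidablePred (fun h : G => h⁻¹ * g * h ∈ Subgroup.centralizer ({g'} : Set G)) :=
    fun _ => Classical.propDecidable _
  (Nat.card (Subgroup.centralizer ({g} : Set G)) : ℂ)⁻¹ *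
  (Nat.card (Subgroup.centralizer ({g'} : Set G)) : ℂ)⁻¹ *
  ∑ h : G, if hh : h⁻¹ * g * h ∈ Subgroup.centralizer ({g'} : Set G) then
      χ ⟨h * g' * h⁻¹, mem_centralizer_conj hh⟩ *
      χ' ⟨h⁻¹ * g⁻¹ * h, mem_centralizer_conj_inv hh⟩
    else 0

open CategoryTheory

open scoped MonoidAlgebra

theorem lz_simple {H : Type} [Group H] [Fintype H] (m : Submodule ℂ[H] ℂ[H])
    [IsSimpleModule ℂ[H] m] :
    Simple (FDRep.of (Representation.ofModule' (k := ℂ) (G := H) m)) := by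
  have : Module.Finite ℂ m :=
    Module.Finite.of_injective (m.subtype.restrictScalars ℂ) (Submodule.subtype_injective m)
  have : NeZero (Nat.card H : ℂ) := ⟨by simp⟩
  rw [FDRep.simple_iff_end_is_rank_one]
  have hb := IsSimpleModule.algebraMap_end_bijective_of_isAlgClosed ℂ (A := ℂ[H]) (V := m)
  have hn : Nontrivial m := IsSimpleModule.nontrivial ℂ[H] m
  refine finrank_eq_one (𝟙 _) ?_ ?_
  · intro h
    obtain ⟨v, hv⟩ := exists_ne (0 : m)
    apply hv
    have := congrArg (fun f => f.hom.hom.hom v) h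
    exact this
  · intro w
    let f : m →ₗ[ℂ] m := w.hom.hom.hom
    have hf : ∀ (h : H) (v : m), f (MonoidAlgebra.single h (1:ℂ) • v)
        = MonoidAlgebra.single h (1:ℂ) • f v := by
      intro h v
      have := congrArg (fun f => f.hom.hom v) (w.comm h)
      exact this
    obtain ⟨c, hc⟩ := hb.2 (MonoidAlgebra.equivariantOfLinearOfComm f hf)
    refine ⟨c, ?_⟩
    refine Action.Hom.ext (InducedCategory.hom_ext (ModuleCat.hom_ext (LinearMap.ext fun v => ?_)))
    have := congrArg (fun f => f v) hc
    exact this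

theorem lz_complete {H : Type} [Group H] [Fintype H] (f : H → ℂ)
    (hf : ∀ x y, f (x * y) = f (y * x))
    (h0 : ∀ W : FDRep ℂ H, Simple W → ∑ h, f h * W.character h = 0) (x : H) : f x = 0 := by
  have : NeZero (Nat.card H : ℂ) := ⟨by simp⟩
  let a : ℂ[H] := ∑ h, MonoidAlgebra.single h (f h)
  have hcomm1 : ∀ g : H, a * MonoidAlgebra.single g (1:ℂ) = MonoidAlgebra.single g (1:ℂ) * a := by
    intro g
    simp only [a, Finset.sum_mul, Finset.mul_sum, MonoidAlgebra.single_mul_single, mul_one, one_mul]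
    refine Fintype.sum_equiv ((Equiv.mulRight g).trans (Equiv.mulLeft g⁻¹)) _ _ ?_
    intro h
    simp [hf g⁻¹]
  have hann : ∀ m : Submodule ℂ[H] ℂ[H], IsSimpleModule ℂ[H] m → ∀ v : m, a • v = 0 := by
    intro m hm
    have : Module.Finite ℂ m :=
      Module.Finite.of_injective (m.subtype.restrictScalars ℂ) (Submodule.subtype_injective m)
    have hb := IsSimpleModule.algebraMap_end_bijective_of_isAlgClosed ℂ (A := ℂ[H]) (V := m)
    have hn : Nontrivial m := IsSimpleModule.nontrivial ℂ[H] m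
    let L : m →ₗ[ℂ] m := Algebra.lsmul ℂ ℂ m a
    obtain ⟨c, hc⟩ := hb.2 (MonoidAlgebra.equivariantOfLinearOfComm L (by
      intro h v
      change a • MonoidAlgebra.single h (1:ℂ) • v = MonoidAlgebra.single h (1:ℂ) • a • v
      rw [smul_smul, smul_smul, hcomm1]))
    have hc' : ∀ v : m, a • v = c • v := fun v => (congrArg (fun f => f v) hc).symm
    have hL : L = c • LinearMap.id := by
      ext1 v
      exact hc' v
    have htr : LinearMap.trace ℂ m L = 0 := by
      rw [← h0 _ (lz_simple m)]
      simp only [L, a, map_sum]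
      refine Finset.sum_congr rfl fun h _ => ?_
      have : (MonoidAlgebra.single h (f h) : ℂ[H]) = f h • MonoidAlgebra.single h 1 := by
        simp
      rw [this, map_smul, map_smul]
      rfl
    rw [hL, map_smul, LinearMap.trace_id, smul_eq_mul] at htr
    have hfr : (Module.finrank ℂ m : ℂ) ≠ 0 := by
      exact_mod_cast Module.finrank_pos.ne'
    have hc0 : c = 0 := by simpa [hfr] using htr
    intro v
    rw [hc', hc0, zero_smul]
  have hz : a = 0 := by
    have hmem : (1 : ℂ[H]) ∈ sSup {m : Submodule ℂ[H] ℂ[H] | IsSimpleModule ℂ[H] m} := by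
      rw [IsSemisimpleModule.sSup_simples_eq_top]; trivial
    rw [sSup_eq_iSup'] at hmem
    have : a * 1 = 0 := by
      refine Submodule.iSup_induction _ (motive := fun v => a * v = 0) hmem ?_ (mul_zero _) ?_
      · rintro ⟨m, hm⟩ v hv
        exact congrArg Subtype.val (hann m hm ⟨v, hv⟩)
      · intro u v hu hv
        rw [mul_add, hu, hv, add_zero]
    simpa using this
  have := congrArg (fun b : ℂ[H] => b.coeff x) hz
  simp only [a, MonoidAlgebra.coeff_sum, Finsupp.coe_finsetSum, Finset.sum_apply,
    MonoidAlgebra.coeff_single, MonoidAlgebra.coeff_zero, Finsupp.coe_zero, Pi.zero_apply] at this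
  rw [Finset.sum_eq_single x (fun b _ hb => Finsupp.single_eq_of_ne hb.symm) (by simp)] at this
  simpa using this

open Classical in
theorem lz_col {H : Type} [Group H] [Fintype H] {ι : Type} [Fintype ι] (V : ι → FDRep ℂ H)
    (hs : ∀ i, Simple (V i)) (hp : ∀ i j, Nonempty (V i ≅ V j) → i = j)
    (hall : ∀ W : FDRep ℂ H, Simple W → ∃ i, Nonempty (W ≅ V i)) (x y : H) :
    ∑ j, (V j).character y⁻¹ * (V j).character x = ∑ h : H, if h * x * h⁻¹ = y then (1:ℂ) else 0 := by
  have hcard : (Nat.card H : ℂ) ≠ 0 := by simp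
  have : Invertible (Nat.card H : ℂ) := invertibleOfNonzero hcard
  rw [← sub_eq_zero]
  set F : H → ℂ := fun x => ∑ j, (V j).character y⁻¹ * (V j).character x -
    ∑ h : H, if h * x * h⁻¹ = y then (1:ℂ) else 0 with hF
  have hclass : ∀ u v, F (u * v) = F (v * u) := by
    intro u v
    simp only [hF, FDRep.char_mul_comm _ u v]
    congr 1
    refine Fintype.sum_equiv (Equiv.mulRight u) _ _ ?_
    intro h
    simp [mul_assoc]
  suffices h : (fun x => F x⁻¹) x⁻¹ = 0 by simpa [hF] using h
  refine lz_complete (fun x => F x⁻¹) (fun u v => by simp [hclass]) ?_ _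
  intro W hW
  obtain ⟨k, ⟨e⟩⟩ := hall W hW
  rw [FDRep.char_iso e]
  rw [← Equiv.sum_comp (Equiv.inv H)]
  simp only [Equiv.inv_apply, inv_inv, hF, sub_mul, Finset.sum_sub_distrib, Finset.sum_mul]
  rw [sub_eq_zero, Finset.sum_comm, Finset.sum_comm (s := (Finset.univ : Finset H))]
  have h1 : ∀ j, ∑ x, (V j).character x * (V k).character x⁻¹
      = if j = k then (Nat.card H : ℂ) else 0 := by
    intro j
    have := hs j
    have := hs k
    have h := FDRep.char_orthonormal (V j) (V k)
    have hiff : Nonempty (V j ≅ V k) ↔ j = k := ⟨hp j k, fun h => h ▸ ⟨Iso.refl _⟩⟩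
    rw [inv_mul_eq_iff_eq_mul₀ hcard] at h
    rw [h]
    by_cases hjk : j = k <;> simp [hiff, hjk]
  have h2 : ∀ h : H, ∑ x, (if h * x * h⁻¹ = y then (1:ℂ) else 0) * (V k).character x⁻¹
      = (V k).character y⁻¹ := by
    intro h
    rw [Finset.sum_eq_single (h⁻¹ * y * h)]
    · rw [if_pos (by group), one_mul, ← FDRep.char_conj (V k) _ h]
      congr 1
      group
    · intro b _ hb
      rw [if_neg, zero_mul]
      rintro rfl
      apply hb
      group
    · simp
  rw [Finset.sum_congr rfl (fun h _ => h2 h)]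
  simp only [mul_assoc, ← Finset.mul_sum, h1]
  simp [mul_comm]

open Classical in
/-- Extension by zero of a function on the centralizer of `g`. -/
noncomputable def lzE {G : Type} [Group G] {g : G}
    (χ : Subgroup.centralizer ({g} : Set G) → ℂ) (x : G) : ℂ :=
  if h : x ∈ Subgroup.centralizer ({g} : Set G) then χ ⟨x, h⟩ else 0

theorem lzE_mem {G : Type} [Group G] {g : G}
    (χ : Subgroup.centralizer ({g} : Set G) → ℂ) {x : G}
    (h : x ∈ Subgroup.centralizer ({g} : Set G)) : lzE χ x = χ ⟨x, h⟩ := dif_pos h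

theorem lzE_not_mem {G : Type} [Group G] {g : G}
    (χ : Subgroup.centralizer ({g} : Set G) → ℂ) {x : G}
    (h : x ∉ Subgroup.centralizer ({g} : Set G)) : lzE χ x = 0 := dif_neg h

theorem lz_mem_inv {G : Type} [Group G] (g g' h : G) :
    h⁻¹ * g⁻¹ * h ∈ Subgroup.centralizer ({g'} : Set G) ↔
    h⁻¹ * g * h ∈ Subgroup.centralizer ({g'} : Set G) := by
  rw [← inv_mem_iff]
  simp [mul_assoc]

theorem lz_mem_conj {G : Type} [Group G] (g g' h : G) :
    h * g' * h⁻¹ ∈ Subgroup.centralizer ({g} : Set G) ↔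
    h⁻¹ * g * h ∈ Subgroup.centralizer ({g'} : Set G) := by
  refine ⟨fun hh => ?_, mem_centralizer_conj⟩
  have := mem_centralizer_conj (g := g') (g' := g) (h := h⁻¹) (by simpa using hh)
  simpa using this

theorem lz_pair {G : Type} [Group G] [Fintype G]
    (g g' : G) (χ : Subgroup.centralizer ({g} : Set G) → ℂ)
    (χ' : Subgroup.centralizer ({g'} : Set G) → ℂ) :
    lusztigPair g g' χ χ' = (Nat.card (Subgroup.centralizer ({g} : Set G)) : ℂ)⁻¹ *
      (Nat.card (Subgroup.centralizer ({g'} : Set G)) : ℂ)⁻¹ *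
      ∑ h : G, lzE χ (h * g' * h⁻¹) * lzE χ' (h⁻¹ * g⁻¹ * h) := by
  unfold lusztigPair
  congr 1
  refine Finset.sum_congr rfl fun h _ => ?_
  split_ifs with hh
  · rw [lzE_mem, lzE_mem]
  · rw [lzE_not_mem χ, zero_mul]
    rwa [lz_mem_conj]

theorem lzE_conj {G : Type} [Group G] {g : G}
    (V : FDRep ℂ (Subgroup.centralizer ({g} : Set G))) (x u : G)
    (hu : u ∈ Subgroup.centralizer ({g} : Set G)) :
    lzE V.character (u * x * u⁻¹) = lzE V.character x := by
  by_cases hx : x ∈ Subgroup.centralizer ({g} : Set G)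
  · rw [lzE_mem _ hx, lzE_mem _ (mul_mem (mul_mem hu hx) (inv_mem hu))]
    exact FDRep.char_conj V ⟨x, hx⟩ ⟨u, hu⟩
  · rw [lzE_not_mem _ hx, lzE_not_mem]
    intro h
    apply hx
    have := mul_mem (mul_mem (inv_mem hu) h) hu
    simpa [mul_assoc] using this

open Classical in
theorem lz_sum_sub {G : Type} [Group G] [Fintype G] (S : Subgroup G) (f : G → ℂ) :
    ∑ c : S, f c = ∑ c : G, if c ∈ S then f c else 0 := by
  rw [← Finset.sum_filter]
  symm
  apply Finset.sum_subtype
  simp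

open Classical in
theorem lzE_col {G : Type} [Group G] [Fintype G] (z : G) {ι : Type} [Fintype ι]
    (V : ι → FDRep ℂ (Subgroup.centralizer ({z} : Set G)))
    (hs : ∀ i, Simple (V i)) (hp : ∀ i j, Nonempty (V i ≅ V j) → i = j)
    (hall : ∀ W : FDRep ℂ (Subgroup.centralizer ({z} : Set G)),
      Simple W → ∃ i, Nonempty (W ≅ V i)) (x y : G) :
    ∑ j, lzE (V j).character y⁻¹ * lzE (V j).character x =
      ∑ c : G, if c ∈ Subgroup.centralizer ({z} : Set G) then
        (if y ∈ Subgroup.centralizer ({z} : Set G) ∧ c * x * c⁻¹ = y then (1:ℂ) else 0) else 0 := by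
  by_cases hy : y ∈ Subgroup.centralizer ({z} : Set G)
  · rw [← lz_sum_sub _ (fun c => if y ∈ Subgroup.centralizer ({z} : Set G) ∧
      c * x * c⁻¹ = y then (1:ℂ) else 0)]
    by_cases hx : x ∈ Subgroup.centralizer ({z} : Set G)
    · simp only [lzE_mem _ hx, lzE_mem _ (inv_mem hy)]
      refine (lz_col V hs hp hall ⟨x, hx⟩ ⟨y, hy⟩).trans ?_
      refine Finset.sum_congr rfl fun c _ => ?_
      simp [Subtype.ext_iff, hy]
    · simp only [lzE_not_mem _ hx, mul_zero, Finset.sum_const_zero]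
      symm
      refine Finset.sum_eq_zero fun c _ => if_neg ?_
      rintro ⟨_, h⟩
      apply hx
      have := mul_mem (mul_mem (inv_mem c.2) hy) c.2
      rw [← h] at this
      simpa [mul_assoc] using this
  · simp only [hy, false_and, if_false, ite_self, Finset.sum_const_zero]
    refine Finset.sum_eq_zero fun j _ => ?_
    rw [lzE_not_mem, zero_mul]
    rwa [inv_mem_iff]

open Classical in
theorem lz_count {G : Type} [Group G] [Fintype G] (z y : G) :
    (∑ h : G, if h * z * h⁻¹ = y then (1:ℂ) else 0) =
      if IsConj y z then (Nat.card (Subgroup.centralizer ({z} : Set G)) : ℂ) else 0 := by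
  split_ifs with hc
  · obtain ⟨u, hu⟩ := isConj_iff.1 hc.symm
    have : (Nat.card (Subgroup.centralizer ({z} : Set G)) : ℂ) =
        ∑ c : Subgroup.centralizer ({z} : Set G), (1:ℂ) := by simp
    rw [this, lz_sum_sub _ (fun _ => (1:ℂ))]
    symm
    refine Fintype.sum_equiv (Equiv.mulLeft u) _ _ fun c => ?_
    congr 1
    rw [Subgroup.mem_centralizer_singleton_iff, ← hu]
    simp only [Equiv.coe_mulLeft, mul_inv_rev, eq_iff_iff]
    constructor
    · intro h
      calc u * c * z * (c⁻¹ * u⁻¹) = u * (c * z) * c⁻¹ * u⁻¹ := by group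
        _ = u * z * u⁻¹ := by rw [h]; group
    · intro h
      calc c * z = u⁻¹ * (u * c * z * (c⁻¹ * u⁻¹)) * u * c := by group
        _ = z * c := by rw [h]; group
  · refine Finset.sum_eq_zero fun h _ => if_neg fun hh => hc ?_
    exact (isConj_iff.2 ⟨h, hh⟩).symm

theorem lz_class_sum {G : Type} [Group G] [Fintype G] (R : Finset G)
    (hR : ∀ g : G, ∃! r, r ∈ R ∧ IsConj g r) (φ : G → ℂ) :
    ∑ z ∈ R, (Nat.card (Subgroup.centralizer ({z} : Set G)) : ℂ)⁻¹ * ∑ h : G, φ (h * z * h⁻¹)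
      = ∑ y, φ y := by
  classical
  have h1 : ∀ z : G, ∑ h : G, φ (h * z * h⁻¹) =
      ∑ y, φ y * if IsConj y z then (Nat.card (Subgroup.centralizer ({z} : Set G)) : ℂ) else 0 := by
    intro z
    simp_rw [← lz_count, Finset.mul_sum]
    rw [Finset.sum_comm]
    simp
  simp_rw [h1, Finset.mul_sum]
  rw [Finset.sum_comm]
  refine Finset.sum_congr rfl fun y _ => ?_
  obtain ⟨r, ⟨hr, hyr⟩, hu⟩ := hR y
  rw [Finset.sum_eq_single r]
  · rw [if_pos hyr]
    have : (Nat.card (Subgroup.centralizer ({r} : Set G)) : ℂ) ≠ 0 := by simp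
    field_simp
  · intro b hb hbr
    rw [if_neg]
    · simp
    · intro h
      exact hbr (hu b ⟨hb, h⟩)
  · intro h
    exact absurd hr h

theorem lz_final {G : Type} [Group G] [Fintype G] (g : G)
    (V W : FDRep ℂ (Subgroup.centralizer ({g} : Set G))) [Simple V] [Simple W] [Decidable (Nonempty (V ≅ W))] :
    (Nat.card (Subgroup.centralizer ({g} : Set G)) : ℂ)⁻¹ *
      ∑ y : G, lzE V.character y * lzE W.character y⁻¹ = if Nonempty (V ≅ W) then 1 else 0 := by
  classical
  have hcard : (Nat.card (Subgroup.centralizer ({g} : Set G)) : ℂ) ≠ 0 := by simp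
  have : Invertible (Nat.card (Subgroup.centralizer ({g} : Set G)) : ℂ) :=
    invertibleOfNonzero hcard
  have h := FDRep.char_orthonormal V W
  have h2 : ∑ y : G, lzE V.character y * lzE W.character y⁻¹ =
      ∑ y : Subgroup.centralizer ({g} : Set G), V.character y * W.character y⁻¹ := by
    trans ∑ y : Subgroup.centralizer ({g} : Set G), lzE V.character y * lzE W.character (y : G)⁻¹
    · rw [lz_sum_sub _ (fun y : G => lzE V.character y * lzE W.character y⁻¹)]
      refine Finset.sum_congr rfl fun y _ => ?_
      split_ifs with hy
      · rfl
      · rw [lzE_not_mem _ hy, zero_mul]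
    · refine Finset.sum_congr rfl fun y _ => ?_
      rw [lzE_mem _ y.2, lzE_mem _ (inv_mem y.2)]
      rfl
  rw [h2, h]
  congr

open Classical in
theorem lz_inner {G : Type} [Group G] [Fintype G] (g g' z : G) {ι : Type} [Fintype ι]
    (V : ι → FDRep ℂ (Subgroup.centralizer ({z} : Set G)))
    (hs : ∀ i, Simple (V i)) (hp : ∀ i j, Nonempty (V i ≅ V j) → i = j)
    (hall : ∀ W : FDRep ℂ (Subgroup.centralizer ({z} : Set G)),
      Simple W → ∃ i, Nonempty (W ≅ V i))
    (χ : Subgroup.centralizer ({g} : Set G) → ℂ)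
    (χ' : Subgroup.centralizer ({g'} : Set G) → ℂ) :
    ∑ j, lusztigPair g z χ (V j).character * lusztigPair z g' (V j).character χ' =
      (Nat.card (Subgroup.centralizer ({g} : Set G)) : ℂ)⁻¹ *
      (Nat.card (Subgroup.centralizer ({z} : Set G)) : ℂ)⁻¹ *
      (Nat.card (Subgroup.centralizer ({z} : Set G)) : ℂ)⁻¹ *
      (Nat.card (Subgroup.centralizer ({g'} : Set G)) : ℂ)⁻¹ *
      ∑ h : G, ∑ k : G, lzE χ (h * z * h⁻¹) * lzE χ' (k⁻¹ * z⁻¹ * k) *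
      ∑ c : G, if c ∈ Subgroup.centralizer ({z} : Set G) then
        (if h⁻¹ * g * h ∈ Subgroup.centralizer ({z} : Set G) ∧
          c * (k * g' * k⁻¹) * c⁻¹ = h⁻¹ * g * h then (1:ℂ) else 0) else 0 := by
  have hcol := fun h k : G => (lzE_col z V hs hp hall (k * g' * k⁻¹) (h⁻¹ * g * h)).symm
  rw [Finset.sum_congr rfl fun h _ => Finset.sum_congr rfl fun k _ => congrArg _ (hcol h k)]
  have hpair := fun j : ι => congrArg₂ (fun a b : ℂ => a * b)
    (lz_pair g z χ (V j).character) (lz_pair z g' (V j).character χ')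
  rw [Finset.sum_congr rfl fun j _ => hpair j]
  simp_rw [Finset.mul_sum, Finset.sum_mul]
  rw [Finset.sum_comm' (t' := Finset.univ) (s' := fun _ => Finset.univ) (by simp),
    Finset.sum_congr rfl fun k _ => Finset.sum_comm, Finset.sum_comm]
  refine Finset.sum_congr rfl fun h _ => ?_
  refine Finset.sum_congr rfl fun k _ => Finset.sum_congr rfl fun j _ => ?_
  have : (h⁻¹ * g * h)⁻¹ = h⁻¹ * g⁻¹ * h := by group
  rw [this]
  ring

open Classical in
theorem lz_inner_same {G : Type} [Group G] [Fintype G] (g z : G)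
    (A B : FDRep ℂ (Subgroup.centralizer ({g} : Set G))) :
      ∑ h : G, ∑ k : G, lzE A.character (h * z * h⁻¹) * lzE B.character (k⁻¹ * z⁻¹ * k) *
      (∑ c : G, if c ∈ Subgroup.centralizer ({z} : Set G) then
        (if h⁻¹ * g * h ∈ Subgroup.centralizer ({z} : Set G) ∧
          c * (k * g * k⁻¹) * c⁻¹ = h⁻¹ * g * h then (1:ℂ) else 0) else 0) =
      (Nat.card (Subgroup.centralizer ({z} : Set G)) : ℂ) *
      (Nat.card (Subgroup.centralizer ({g} : Set G)) : ℂ) *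
      ∑ h : G, lzE A.character (h * z * h⁻¹) * lzE B.character (h * z * h⁻¹)⁻¹ := by
  rw [Finset.mul_sum]
  refine Finset.sum_congr rfl fun h _ => ?_
  by_cases hh : h⁻¹ * g * h ∈ Subgroup.centralizer ({z} : Set G)
  swap
  · rw [lzE_not_mem _ (by rwa [lz_mem_conj])]
    simp
  simp_rw [Finset.mul_sum]
  rw [Finset.sum_comm]
  have hcz : (Nat.card (Subgroup.centralizer ({z} : Set G)) : ℂ) =
      ∑ c : G, if c ∈ Subgroup.centralizer ({z} : Set G) then (1:ℂ) else 0 := by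
    rw [← lz_sum_sub _ (fun _ => (1:ℂ))]; simp
  have hcg : (Nat.card (Subgroup.centralizer ({g} : Set G)) : ℂ) =
      ∑ c : G, if c ∈ Subgroup.centralizer ({g} : Set G) then (1:ℂ) else 0 := by
    rw [← lz_sum_sub _ (fun _ => (1:ℂ))]; simp
  rw [hcz, hcg, Finset.sum_mul, Finset.sum_mul]
  refine Finset.sum_congr rfl fun c _ => ?_
  by_cases hc : c ∈ Subgroup.centralizer ({z} : Set G)
  swap
  · simp [hc]
  simp only [hc, if_true, hh, true_and, one_mul]
  rw [Finset.sum_mul]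
  refine Fintype.sum_equiv (Equiv.mulLeft (h * c)) _ _ fun k => ?_
  rw [Equiv.coe_mulLeft]
  have hiff : c * (k * g * k⁻¹) * c⁻¹ = h⁻¹ * g * h ↔
      h * c * k ∈ Subgroup.centralizer ({g} : Set G) := by
    rw [Subgroup.mem_centralizer_singleton_iff]
    constructor
    · intro e
      calc h * c * k * g = h * (c * (k * g * k⁻¹) * c⁻¹) * c * k := by group
        _ = g * (h * c * k) := by rw [e]; group
    · intro e
      calc c * (k * g * k⁻¹) * c⁻¹ = h⁻¹ * (h * c * k * g) * k⁻¹ * c⁻¹ := by group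
        _ = h⁻¹ * g * h := by rw [e]; group
  by_cases hu : h * c * k ∈ Subgroup.centralizer ({g} : Set G)
  swap
  · simp [hiff, hu]
  rw [if_pos (hiff.2 hu), if_pos hu, mul_one, one_mul]
  congr 1
  rw [← lzE_conj B _ _ hu]
  congr 1
  rw [Subgroup.mem_centralizer_singleton_iff] at hc
  calc h * c * k * (k⁻¹ * z⁻¹ * k) * (h * c * k)⁻¹ = h * (c * z * c⁻¹)⁻¹ * h⁻¹ := by group
    _ = (h * z * h⁻¹)⁻¹ := by rw [hc]; group


open Classical in
/-- Let G be a finite group, R a set of representatives for the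
conjugacy classes of G, and for each r ∈ R let (V r i)_{i : ι r} be a finite family
of pairwise non-isomorphic irreducible finite-dimensional complex representations of
Z_G(r) exhausting all the irreducible representations of Z_G(r), with characters
forming M(G). Then the matrix ({m,m'})_{m,m' ∈ M(G)} of Lusztig pairings has square
equal to the identity matrix. -/
theorem lusztigPair_matrix_sq_eq_id
    {G : Type} [Group G] [Fintype G]
    (R : Finset G)
    (hR : ∀ g : G, ∃! r, r ∈ R ∧ IsConj g r)
    (ι : G → Type) [∀ r, Fintype (ι r)]
    (V : ∀ r : G, ι r → FDRep ℂ ↥(Subgroup.centralizer ({r} : Set G)))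
    (hsimple : ∀ r ∈ R, ∀ i : ι r, Simple (V r i))
    (hpairwise : ∀ r ∈ R, ∀ i j : ι r, Nonempty (V r i ≅ V r j) → i = j)
    (hall : ∀ r ∈ R, ∀ W : FDRep ℂ ↥(Subgroup.centralizer ({r} : Set G)),
      Simple W → ∃ i : ι r, Nonempty (W ≅ V r i))
    (g g' : G) (hg : g ∈ R) (hg' : g' ∈ R) (i : ι g) (i' : ι g') :
    ∑ z ∈ R, ∑ j : ι z,
        lusztigPair g z (V g i).character (V z j).character *
          lusztigPair z g' (V z j).character (V g' i').character =
      if g = g' ∧ HEq i i' then 1 else 0 := by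
  have hin := fun z (hz : z ∈ R) => lz_inner g g' z (V z) (hsimple z hz) (hpairwise z hz)
    (hall z hz) (V g i).character (V g' i').character
  rw [Finset.sum_congr rfl hin]
  by_cases hgg : g = g'
  swap
  · rw [if_neg (fun h => hgg h.1)]
    refine Finset.sum_eq_zero fun z _ => ?_
    refine mul_eq_zero_of_right _ ?_
    refine Finset.sum_eq_zero fun h _ => Finset.sum_eq_zero fun k _ => ?_
    refine mul_eq_zero_of_right _ ?_
    refine Finset.sum_eq_zero fun c _ => ?_
    split_ifs with h1 h2
    · exfalso
      apply hgg
      obtain ⟨r, _, hu⟩ := hR g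
      rw [hu g ⟨hg, IsConj.refl g⟩]
      refine (hu g' ⟨hg', IsConj.symm (isConj_iff.2 ⟨h * c * k, ?_⟩)⟩).symm
      calc h * c * k * g' * (h * c * k)⁻¹ = h * (c * (k * g' * k⁻¹) * c⁻¹) * h⁻¹ := by group
        _ = g := by rw [h2.2]; group
    · rfl
    · rfl
  subst hgg
  have : Simple (V g i) := hsimple g hg i
  have : Simple (V g i') := hsimple g hg i'
  have hfin := lz_final g (V g i) (V g i')
  rw [← lz_class_sum R hR (fun y => lzE (V g i).character y * lzE (V g i').character y⁻¹),
    Finset.mul_sum] at hfin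
  trans (if Nonempty (V g i ≅ V g i') then (1:ℂ) else 0)
  · rw [← hfin]
    refine Finset.sum_congr rfl fun z _ => ?_
    rw [lz_inner_same]
    have h1 : (Nat.card (Subgroup.centralizer ({g} : Set G)) : ℂ) ≠ 0 := by simp
    have h2 : (Nat.card (Subgroup.centralizer ({z} : Set G)) : ℂ) ≠ 0 := by simp
    field_simp
  · have hiff : Nonempty (V g i ≅ V g i') ↔ (g = g ∧ HEq i i') := by
      constructor
      · intro h
        exact ⟨rfl, heq_of_eq (hpairwise g hg i i' h)⟩
      · rintro ⟨_, h⟩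
        have := eq_of_heq h
        subst this
        exact ⟨Iso.refl _⟩
    simp only [hiff]
end

section
/- Let G be a finite group and let U, U' be G-equivariant vector bundles on G (for the conjugation action). For each y ∈ G define π_y : (U*U')_y → (U'*U)_y on the summand U_g ⊗ U'_{g'} (where gg' = y) by π_y(u ⊗ u') = ψ^{U'}_{g,g'}(u') ⊗ u, landing in the summand U'_{gg'g⁻¹} ⊗ U_g (note (gg'g⁻¹)·g = y). Then each π_y is a linear isomorphism, and the family π = (π_y)_{y∈G} is an isomorphism of G-equivariant vector bundles U*U' → U'*U, i.e., π_{xyx⁻¹} ∘ ψ^{U*U'}_{x,y} = ψ^{U'*U}_{x,y} ∘ π_y for all x, y ∈ G. -/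
open TensorProduct DirectSum

/-- A `G`-equivariant complex vector bundle on `G`, for the conjugation action of `G`
on itself: a family `(U_g)` of finite-dimensional complex vector spaces together with
linear isomorphisms `ψ_{x,y} : U_y → U_{xyx⁻¹}` satisfying `ψ_{1,y} = id` and
`ψ_{x₁x₂,y} = ψ_{x₁,x₂yx₂⁻¹} ∘ ψ_{x₂,y}`. -/
structure EquivariantBundle (G : Type*) [Group G] where
  fiber : G → Type*
  [fiberAddCommGroup : ∀ g, AddCommGroup (fiber g)]
  [fiberModule : ∀ g, Module ℂ (fiber g)]
  [fiberFiniteDimensional : ∀ g, FiniteDimensional ℂ (fiber g)]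
  ψ : ∀ x y : G, fiber y →ₗ[ℂ] fiber (x * y * x⁻¹)
  ψ_bijective : ∀ x y : G, Function.Bijective (ψ x y)
  ψ_one : ∀ y : G, HEq (ψ 1 y) (LinearMap.id : fiber y →ₗ[ℂ] fiber y)
  ψ_mul : ∀ x₁ x₂ y : G,
    HEq (ψ (x₁ * x₂) y) ((ψ x₁ (x₂ * y * x₂⁻¹)).comp (ψ x₂ y))

attribute [instance] EquivariantBundle.fiberAddCommGroup EquivariantBundle.fiberModule
  EquivariantBundle.fiberFiniteDimensional

variable {G : Type*} [Group G] [DecidableEq G]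

/-- The index set for the fiber of the convolution at `y`: pairs `(g,g')` with
`g * g' = y`. -/
abbrev ConvIndex (G : Type*) [Mul G] (y : G) : Type _ := {p : G × G // p.1 * p.2 = y}

/-- The fiber of the convolution `U * U'` at `y`:
`(U*U')_y = ⊕_{(g,g') : g g' = y} U_g ⊗ U'_{g'}`. -/
noncomputable def convFiber (U U' : EquivariantBundle G) (y : G) : Type _ :=
  ⨁ p : ConvIndex G y, (U.fiber p.1.1 ⊗[ℂ] U'.fiber p.1.2)

noncomputable instance (U U' : EquivariantBundle G) (y : G) :
    AddCommGroup (convFiber U U' y) := by unfold convFiber; infer_instance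

noncomputable instance (U U' : EquivariantBundle G) (y : G) :
    Module ℂ (convFiber U U' y) := by unfold convFiber; infer_instance

/-- The equivariant structure map `ψ^{U*U'}_{x,y} : (U*U')_y → (U*U')_{xyx⁻¹}`, mapping
the summand `U_g ⊗ U'_{g'}` (for `g g' = y`) to the summand
`U_{xgx⁻¹} ⊗ U'_{xg'x⁻¹}` via `ψ^U_{x,g} ⊗ ψ^{U'}_{x,g'}`. -/
noncomputable def convPsi (U U' : EquivariantBundle G) (x y : G) :
    convFiber U U' y →ₗ[ℂ] convFiber U U' (x * y * x⁻¹) :=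
  DirectSum.toModule ℂ (ConvIndex G y) (convFiber U U' (x * y * x⁻¹)) fun p =>
    (DirectSum.lof ℂ (ConvIndex G (x * y * x⁻¹))
        (fun q => U.fiber q.1.1 ⊗[ℂ] U'.fiber q.1.2)
        ⟨(x * p.1.1 * x⁻¹, x * p.1.2 * x⁻¹), by
          obtain ⟨⟨g, g'⟩, hp⟩ := p
          show (x * g * x⁻¹) * (x * g' * x⁻¹) = x * y * x⁻¹
          rw [← hp]; group⟩).comp
      (TensorProduct.map (U.ψ x p.1.1) (U'.ψ x p.1.2))
/-- The map `π_y : (U*U')_y → (U'*U)_y`, given on the summand `U_g ⊗ U'_{g'}`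
(`g g' = y`) by `u ⊗ u' ↦ ψ^{U'}_{g,g'}(u') ⊗ u`, landing in the summand
`U'_{gg'g⁻¹} ⊗ U_g` (note `(gg'g⁻¹)·g = y`). -/
noncomputable def convSwap (U U' : EquivariantBundle G) (y : G) :
    convFiber U U' y →ₗ[ℂ] convFiber U' U y :=
  DirectSum.toModule ℂ (ConvIndex G y) (convFiber U' U y) fun p =>
    (DirectSum.lof ℂ (ConvIndex G y)
        (fun q => U'.fiber q.1.1 ⊗[ℂ] U.fiber q.1.2)
        ⟨(p.1.1 * p.1.2 * p.1.1⁻¹, p.1.1), by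
          obtain ⟨⟨g, g'⟩, hp⟩ := p
          show (g * g' * g⁻¹) * g = y
          rw [inv_mul_cancel_right]; exact hp⟩).comp
      ((TensorProduct.map (U'.ψ p.1.1 p.1.2)
          (LinearMap.id : U.fiber p.1.1 →ₗ[ℂ] U.fiber p.1.1)).comp
        (TensorProduct.comm ℂ (U.fiber p.1.1) (U'.fiber p.1.2)).toLinearMap)

theorem aux_toModule_bijective {ι κ : Type*} [DecidableEq ι] [DecidableEq κ]
    {M : ι → Type*} {N : κ → Type*}
    [∀ i, AddCommGroup (M i)] [∀ i, Module ℂ (M i)]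
    [∀ i, AddCommGroup (N i)] [∀ i, Module ℂ (N i)]
    (σ : ι → κ) (hσ : Function.Bijective σ) (f : ∀ i, M i →ₗ[ℂ] N (σ i))
    (hf : ∀ i, Function.Bijective (f i)) :
    Function.Bijective (DirectSum.toModule ℂ ι (⨁ k, N k)
      fun i => (DirectSum.lof ℂ κ N (σ i)).comp (f i)) := by
  constructor
  · have key : ∀ (z : ⨁ i, M i) (p : ι),
        (DirectSum.toModule ℂ ι (⨁ k, N k)
          (fun i => (DirectSum.lof ℂ κ N (σ i)).comp (f i)) z) (σ p) = f p (z p) := by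
      intro z p
      induction z using DirectSum.induction_on with
      | zero => simp
      | of i x =>
        rw [← DirectSum.lof_eq_of ℂ, DirectSum.toModule_lof, LinearMap.comp_apply,
          DirectSum.lof_eq_of, DirectSum.lof_eq_of]
        by_cases h : i = p
        · subst h
          rw [DirectSum.of_eq_same, DirectSum.of_eq_same]
        · rw [DirectSum.of_eq_of_ne _ _ _ (fun e => h (hσ.1 e).symm ),
            DirectSum.of_eq_of_ne _ _ _ (fun e => h e.symm), map_zero]
      | add a b ha hb => rw [map_add, DirectSum.add_apply, ha, hb, DirectSum.add_apply, map_add]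
    rw [injective_iff_map_eq_zero]
    intro z hz
    ext p
    apply (hf p).1
    rw [← key, hz]
    simp
  · intro w
    induction w using DirectSum.induction_on with
    | zero => exact ⟨0, map_zero _⟩
    | of k n =>
      obtain ⟨i, rfl⟩ := hσ.2 k
      obtain ⟨m, rfl⟩ := (hf i).2 n
      exact ⟨DirectSum.lof ℂ ι M i m, by rw [DirectSum.toModule_lof]; rfl⟩
    | add a b ha hb =>
      obtain ⟨a, rfl⟩ := ha
      obtain ⟨b, rfl⟩ := hb
      exact ⟨a + b, map_add _ _ _⟩

theorem aux_heq_apply {G : Type*} [Group G] (U : EquivariantBundle G) {a b c : G} (h : b = c)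
    (f : U.fiber a →ₗ[ℂ] U.fiber b) (g : U.fiber a →ₗ[ℂ] U.fiber c) (hfg : HEq f g)
    (u : U.fiber a) : HEq (f u) (g u) := by
  subst h
  rw [eq_of_heq hfg]

theorem aux_psi_mul {G : Type*} [Group G] (U : EquivariantBundle G) (x₁ x₂ y : G)
    (u : U.fiber y) :
    HEq (U.ψ (x₁ * x₂) y u) (U.ψ x₁ (x₂ * y * x₂⁻¹) (U.ψ x₂ y u)) :=
  aux_heq_apply U (by group) _ _ (U.ψ_mul x₁ x₂ y) u

theorem aux_psi_congr {G : Type*} [Group G] (U : EquivariantBundle G) {x₁ x₂ : G} (y : G)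
    (h : x₁ = x₂) (u : U.fiber y) : HEq (U.ψ x₁ y u) (U.ψ x₂ y u) := by
  subst h; rfl

theorem aux_lof_congr {G : Type*} [Group G] [DecidableEq G] (U U' : EquivariantBundle G) (y : G)
    {a b c d : G} (hab : a * b = y) (hcd : c * d = y) (hac : a = c) (hbd : b = d)
    {u : U.fiber a} {v : U.fiber c} {u' : U'.fiber b} {v' : U'.fiber d}
    (huv : HEq u v) (huv' : HEq u' v') :
    DirectSum.lof ℂ (ConvIndex G y) (fun q => U.fiber q.1.1 ⊗[ℂ] U'.fiber q.1.2)
      ⟨(a, b), hab⟩ (u ⊗ₜ[ℂ] u') =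
    DirectSum.lof ℂ (ConvIndex G y) (fun q => U.fiber q.1.1 ⊗[ℂ] U'.fiber q.1.2)
      ⟨(c, d), hcd⟩ (v ⊗ₜ[ℂ] v') := by
  subst hac hbd
  rw [eq_of_heq huv, eq_of_heq huv']

theorem aux_swap_lof {G : Type*} [Group G] [DecidableEq G]
    (V V' : EquivariantBundle G) (y a b : G) (hab : a * b = y) (t : V.fiber a)
        (t' : V'.fiber b) :
    convSwap V V' y (DirectSum.lof ℂ (ConvIndex G y)
          (fun q => V.fiber q.1.1 ⊗[ℂ] V'.fiber q.1.2) ⟨(a, b), hab⟩ (t ⊗ₜ[ℂ] t')) =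
        DirectSum.lof ℂ (ConvIndex G y) (fun q => V'.fiber q.1.1 ⊗[ℂ] V.fiber q.1.2)
          ⟨(a * b * a⁻¹, a), by rw [inv_mul_cancel_right]; exact hab⟩
          (V'.ψ a b t' ⊗ₜ[ℂ] t) :=
      DirectSum.toModule_lof ℂ _ _

theorem aux_psi_lof {G : Type*} [Group G] [DecidableEq G] (V V' : EquivariantBundle G) (x : G)
    (y a b : G) (hab : a * b = y) (t : V.fiber a)
        (t' : V'.fiber b) :
    convPsi V V' x y (DirectSum.lof ℂ (ConvIndex G y)
          (fun q => V.fiber q.1.1 ⊗[ℂ] V'.fiber q.1.2) ⟨(a, b), hab⟩ (t ⊗ₜ[ℂ] t')) =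
        DirectSum.lof ℂ (ConvIndex G (x * y * x⁻¹))
          (fun q => V.fiber q.1.1 ⊗[ℂ] V'.fiber q.1.2)
          ⟨(x * a * x⁻¹, x * b * x⁻¹), by rw [← hab]; group⟩
          (V.ψ x a t ⊗ₜ[ℂ] V'.ψ x b t') :=
      DirectSum.toModule_lof ℂ _ _

/-- For G-equivariant vector bundles U, U' on a finite group G, the maps
π_y : (U*U')_y → (U'*U)_y, defined on the summand U_g ⊗ U'_{g'} (gg' = y) by
π_y(u ⊗ u') = ψ^{U'}_{g,g'}(u') ⊗ u ∈ U'_{gg'g⁻¹} ⊗ U_g, are linear isomorphisms and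
the family π = (π_y) is an isomorphism of G-equivariant vector bundles U*U' → U'*U,
i.e. π_{xyx⁻¹} ∘ ψ^{U*U'}_{x,y} = ψ^{U'*U}_{x,y} ∘ π_y for all x, y. -/
theorem convSwap_isIso_of_equivariant {G : Type*} [Group G] [Fintype G] [DecidableEq G]
    (U U' : EquivariantBundle G) :
    (∀ y : G, Function.Bijective (convSwap U U' y)) ∧
    (∀ x y : G, (convSwap U U' (x * y * x⁻¹)).comp (convPsi U U' x y) =
      (convPsi U' U x y).comp (convSwap U U' y)) := by
  refine ⟨fun y => ?_, fun x y => ?_⟩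
  · refine aux_toModule_bijective
      (fun p : ConvIndex G y => (⟨(p.1.1 * p.1.2 * p.1.1⁻¹, p.1.1), by
        rw [inv_mul_cancel_right]; exact p.2⟩ : ConvIndex G y)) ⟨?_, ?_⟩
      (N := fun q : ConvIndex G y => U'.fiber q.1.1 ⊗[ℂ] U.fiber q.1.2)
      (fun p => (TensorProduct.map (U'.ψ p.1.1 p.1.2)
          (LinearMap.id : U.fiber p.1.1 →ₗ[ℂ] U.fiber p.1.1)).comp
        (TensorProduct.comm ℂ (U.fiber p.1.1) (U'.fiber p.1.2)).toLinearMap) ?_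
    · rintro ⟨⟨a, b⟩, h⟩ ⟨⟨c, d⟩, h'⟩ e
      simp only [Subtype.mk.injEq, Prod.mk.injEq] at e
      obtain ⟨e1, rfl⟩ := e
      simpa using e1
    · rintro ⟨⟨a, b⟩, h⟩
      refine ⟨⟨(b, b⁻¹ * a * b), ?_⟩, ?_⟩
      · rw [← h]; simp [mul_assoc]
      · simp [mul_assoc]
    · intro p
      exact ((TensorProduct.comm ℂ (U.fiber p.1.1) (U'.fiber p.1.2)).trans
        (TensorProduct.congr (LinearEquiv.ofBijective _ (U'.ψ_bijective p.1.1 p.1.2))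
          (LinearEquiv.refl ℂ (U.fiber p.1.1)))).bijective
  · apply DirectSum.linearMap_ext
    rintro ⟨⟨g, g'⟩, h⟩
    apply TensorProduct.ext'
    intro u u'
    refine (congrArg (convSwap U U' (x * y * x⁻¹)) (aux_psi_lof U U' x y g g' h u u')).trans ?_
    refine Eq.trans ?_ (congrArg (convPsi U' U x y) (aux_swap_lof U U' y g g' h u u')).symm
    refine (aux_swap_lof U U' _ _ _ _ _ _).trans ?_
    refine Eq.trans ?_ (aux_psi_lof U' U x _ _ _ _ _ _).symm
    refine aux_lof_congr U' U _ _ _ (by group) rfl ?_ HEq.rfl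
    refine (aux_psi_mul U' (x * g * x⁻¹) x g' u').symm.trans ?_
    exact (aux_psi_congr U' g' (by group) u').trans (aux_psi_mul U' x g g' u')
end
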